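/- For all reals B > 2, k > 2 and every ε > 0 there exist a constant C and a threshold N₀ such that for all integers N > N₀ and all reals 2 ≤ Q ≤ (log N)^B: (1/N) Σ_{x ∈ ℤ[i], N(x) < N} ( Σ_q |τ_q(x)| )^k ≤ C · Q^{k+ε}, where the inner sum runs over one representative q of each associate class of nonzero Gaussian integers with N(q) < Q. -/

import Mathlib

open Complex GaussianInt MeasureTheory
open scoped Real ENNReal

noncomputable section
attribute [local instance] Classical.propDecidable

/-- The real inner product on `ℂ ≅ ℝ²`: `⟨z, w⟩ = Re z · Re w + Im z · Im w`. -/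
def cip (z w : ℂ) : ℝ := z.re * w.re + z.im * w.im

/-- `e(t) = exp(2πit)`. -/
def e2 (t : ℝ) : ℂ := Complex.exp (2 * Real.pi * Complex.I * t)

/-- The fundamental box `B_q` of residues modulo `q`:
`B_q = {r : 0 ≤ ⟨r,q⟩ < N(q), 0 ≤ ⟨r,iq⟩ < N(q)}`. -/
def Bq (q : GaussianInt) : Set GaussianInt :=
  {r | 0 ≤ cip (toComplex r) (toComplex q) ∧
       cip (toComplex r) (toComplex q) < Complex.normSq (toComplex q) ∧
       0 ≤ cip (toComplex r) (Complex.I * toComplex q) ∧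
       cip (toComplex r) (Complex.I * toComplex q) < Complex.normSq (toComplex q)}

/-- `𝔸_q`, the reduced residues in `B_q` (gcd with `q` a unit). -/
def Aq (q : GaussianInt) : Set GaussianInt :=
  {r | r ∈ Bq q ∧ IsUnit (EuclideanDomain.gcd r q)}

/-- The Euler totient on `ℤ[i]`: `φ(q) = |𝔸_q|`. -/
def gphi (q : GaussianInt) : ℕ := Nat.card (Aq q)

/-- The Gaussian Ramanujan sum `τ_q(x) = Σ_{n ∈ 𝔸_q} e(⟨x, n/q⟩)`. -/
def gtau (q x : GaussianInt) : ℂ :=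
  ∑' n : Aq q, e2 (cip (toComplex x) (toComplex (n : GaussianInt) / toComplex q))

/-- The Möbius function on `ℤ[i]`: `(-1)^k` on squarefree numbers with `k`
pairwise non-associate prime factors (so `1` on units), and `0` otherwise. -/
def gmu (n : GaussianInt) : ℤ :=
  if n ≠ 0 ∧ Squarefree n then (-1) ^ (UniqueFactorizationMonoid.factors n).card else 0

/-- The von Mangoldt function on `ℤ[i]`: `Λ(n) = log N(ρ)` if `n` is a unit times
`ρ^k` for a Gaussian prime `ρ` and `k ≥ 1`, and `0` otherwise. -/
def gvm (n : GaussianInt) : ℝ :=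
  if h : ∃ ρ : GaussianInt, Irreducible ρ ∧
      ∃ k : ℕ, 1 ≤ k ∧ ∃ u : GaussianInt, IsUnit u ∧ n = u * ρ ^ k
  then Real.log (Complex.normSq (toComplex h.choose)) else 0

/-- `ω ⊆ 𝕋 = ℝ/2πℤ` is an interval (arc) of length `l`. -/
def IsArc (ω : Set Real.Angle) (l : ℝ) : Prop :=
  ∃ a : ℝ, ω = (fun θ : ℝ => (θ : Real.Angle)) '' Set.Ico a (a + l)

/-- `arg z ∈ ω`, as a condition in `𝕋`. -/
def argIn (z : ℂ) (ω : Set Real.Angle) : Prop := (↑(Complex.arg z) : Real.Angle) ∈ ω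

/-- The normalized sector average kernel `M_N^ω`. -/
def Msec (ω : Set Real.Angle) (l : ℝ) (N : ℕ) (n : GaussianInt) : ℝ :=
  if Zsqrtd.norm n < (N : ℤ) ∧ argIn (toComplex n) ω then 2 * Real.pi / (l * N) else 0

/-- The weighted sector average kernel `A_N^ω` (with von Mangoldt weights). -/
def Asec (ω : Set Real.Angle) (l : ℝ) (N : ℕ) (n : GaussianInt) : ℂ :=
  if Zsqrtd.norm n < (N : ℤ) ∧ argIn (toComplex n) ω then
    ((2 * Real.pi / (l * N) : ℝ) : ℂ) * (gvm n : ℂ) else 0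

/-- The canonical representative of a nonzero associate class in `ℤ[i]`. -/
def IsCanon (z : GaussianInt) : Prop := 0 < z.re ∧ 0 ≤ z.im

/-- `Φ(a, q) = τ_q(a)/φ(q)`. -/
def Phi (a q : GaussianInt) : ℂ := gtau q a / (gphi q : ℂ)

/-- `Â_N^ω(α)`: the Fourier transform of the weighted sector average. -/
def Ahat (ω : Set Real.Angle) (l : ℝ) (N : ℕ) (α : ℂ) : ℂ :=
  ((2 * Real.pi / (l * N) : ℝ) : ℂ) *
    ∑' n : {m : GaussianInt // Zsqrtd.norm m < (N : ℤ) ∧ argIn (toComplex m) ω},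
      (gvm (n : GaussianInt) : ℂ) * e2 (cip (toComplex (n : GaussianInt)) α)

/-- `M̂_N^ω(β)`: the Fourier transform of the sector average. -/
def Mhat (ω : Set Real.Angle) (l : ℝ) (N : ℕ) (β : ℂ) : ℂ :=
  ((2 * Real.pi / (l * N) : ℝ) : ℂ) *
    ∑' n : {m : GaussianInt // Zsqrtd.norm m < (N : ℤ) ∧ argIn (toComplex m) ω},
      e2 (cip (toComplex (n : GaussianInt)) β)

/-- The tensor Fejér-type bump `η(ξ₁+iξ₂) = (1-|ξ₁|)₊ (1-|ξ₂|)₊`. -/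
def eta (ξ : ℂ) : ℝ := max 0 (1 - |ξ.re|) * max 0 (1 - |ξ.im|)

/-- `Δ_s(ξ) = η(16^s ξ)`. -/
def Delta (s : ℕ) (ξ : ℂ) : ℝ := eta ((16 : ℂ) ^ s * ξ)

/-- `Δ̌_{q₀}(n) = ∫_{[-1/2,1/2)²} Δ_{q₀}(ξ) e(⟨n, ξ⟩) dξ`. -/
def DeltaCheck (q₀ : ℕ) (n : GaussianInt) : ℂ :=
  ∫ p in (Set.Ico (-(1:ℝ)/2) (1/2)) ×ˢ (Set.Ico (-(1:ℝ)/2) (1/2)),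
    ((Delta q₀ ((p.1 : ℂ) + (p.2 : ℂ) * Complex.I) : ℝ) : ℂ) *
      e2 (cip (toComplex n) ((p.1 : ℂ) + (p.2 : ℂ) * Complex.I))

/-- The Low part `Lo_{Q,N}^ω` with `Q = 2^{q₀}`. -/
def Lo (ω : Set Real.Angle) (l : ℝ) (N : ℕ) (q₀ : ℕ) (x : GaussianInt) : ℂ :=
  (∑' y : GaussianInt, ((Msec ω l N y : ℝ) : ℂ) * DeltaCheck q₀ (x - y)) *
    ∑' q : {q : GaussianInt // IsCanon q ∧ (Zsqrtd.norm q : ℝ) < 2 ^ q₀},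
      ∑' a : Aq (q : GaussianInt),
        Phi (a : GaussianInt) (star (q : GaussianInt)) *
          e2 (cip (toComplex x) (toComplex (a : GaussianInt) / toComplex (q : GaussianInt)))

/-- Distance from `β ∈ ℂ` to the nearest Gaussian integer. -/
def distZi (β : ℂ) : ℝ := Metric.infDist β (Set.range fun n : GaussianInt => toComplex n)

/-- `q` is `Q`-smooth: squarefree with all prime factors of norm at most `Q`. -/
def QSmooth (Q : ℝ) (q : GaussianInt) : Prop :=
  Squarefree q ∧ ∀ ρ : GaussianInt, Irreducible ρ → ρ ∣ q → (Zsqrtd.norm ρ : ℝ) ≤ Q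


/-! ### Counting Gaussian integers and their divisors -/

lemma finite_norm_lt (M : ℝ) : {z : GaussianInt | (Zsqrtd.norm z : ℝ) < M}.Finite := by
  have key : ∀ z ∈ {z : GaussianInt | (Zsqrtd.norm z : ℝ) < M},
      z ∈ (fun p : ℤ × ℤ => (⟨p.1, p.2⟩ : GaussianInt)) ''
        (Set.Icc (-⌈M⌉) ⌈M⌉ ×ˢ Set.Icc (-⌈M⌉) ⌈M⌉) := by
    intro z hz
    have h : Zsqrtd.norm z < ⌈M⌉ := by
      have := (show (Zsqrtd.norm z : ℝ) < M from hz).trans_le (Int.le_ceil M)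
      exact_mod_cast this
    rw [Zsqrtd.norm_def] at h
    refine ⟨(z.re, z.im), ⟨⟨?_, ?_⟩, ?_, ?_⟩, rfl⟩ <;> dsimp only <;>
      nlinarith [mul_self_nonneg z.re, mul_self_nonneg z.im]
  exact (((Set.finite_Icc _ _).prod (Set.finite_Icc _ _)).image _).subset key

/-- The nonzero Gaussian integers of norm less than `M`. -/
def normBall (M : ℝ) : Finset GaussianInt := (finite_norm_lt M).toFinset.erase 0

lemma mem_normBall {M : ℝ} {z : GaussianInt} :
    z ∈ normBall M ↔ z ≠ 0 ∧ (Zsqrtd.norm z : ℝ) < M := by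
  simp [normBall]

lemma one_le_norm {z : GaussianInt} (hz : z ≠ 0) : (1 : ℝ) ≤ Zsqrtd.norm z := by
  have : 0 < Zsqrtd.norm z := GaussianInt.norm_pos.2 hz
  exact_mod_cast this

lemma card_norm_lt_le {M : ℝ} (hM : 1 ≤ M) :
    ((finite_norm_lt M).toFinset.card : ℝ) ≤ 9 * M := by
  set s : ℤ := ⌊√M⌋ with hs
  have hs0 : 0 ≤ s := Int.floor_nonneg.2 (Real.sqrt_nonneg _)
  have hs1 : (s : ℝ) ≤ √M := Int.floor_le _
  have h1 : (1 : ℝ) ≤ √M := Real.one_le_sqrt.2 hM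
  have bd : ∀ a b : ℤ, ((a * a + b * b : ℤ) : ℝ) < M → a ∈ Finset.Icc (-s) s := by
    intro a b h
    have h2 : |(a : ℝ)| ≤ √M := by
      apply Real.abs_le_sqrt
      push_cast at h
      nlinarith [mul_self_nonneg (b : ℝ)]
    have h3 : |a| ≤ s := by
      rw [hs, Int.le_floor]
      exact_mod_cast h2
    rw [Finset.mem_Icc]
    exact abs_le.1 h3
  have hsub : (finite_norm_lt M).toFinset ⊆
      (Finset.Icc (-s) s ×ˢ Finset.Icc (-s) s).image
        (fun p : ℤ × ℤ => (⟨p.1, p.2⟩ : GaussianInt)) := by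
    intro z hz
    have hz' : (Zsqrtd.norm z : ℝ) < M := by simpa using hz
    rw [Finset.mem_image]
    refine ⟨(z.re, z.im), Finset.mem_product.2 ⟨bd z.re z.im ?_, bd z.im z.re ?_⟩, rfl⟩
    · convert hz' using 2
      rw [Zsqrtd.norm_def]; ring
    · convert hz' using 2
      rw [Zsqrtd.norm_def]; ring
  have hc := (Finset.card_le_card hsub).trans Finset.card_image_le
  rw [Finset.card_product, Int.card_Icc] at hc
  have hc' : ((finite_norm_lt M).toFinset.card : ℝ) ≤ (2 * s + 1) * (2 * s + 1) := by
    have h4 : (((s + 1 - -s).toNat : ℤ) : ℝ) = 2 * s + 1 := by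
      rw [Int.toNat_of_nonneg (by omega)]; push_cast; ring
    have h5 : (((s + 1 - -s).toNat : ℕ) : ℝ) = 2 * s + 1 := by exact_mod_cast h4
    rw [← h5]
    exact_mod_cast hc
  have hsq : √M * √M = M := Real.mul_self_sqrt (by linarith)
  have hs0' : (0 : ℝ) ≤ s := by exact_mod_cast hs0
  nlinarith

lemma card_normBall_le {M : ℝ} (hM : 0 ≤ M) : ((normBall M).card : ℝ) ≤ 9 * M := by
  by_cases h : 1 ≤ M
  · refine le_trans ?_ (card_norm_lt_le h)
    exact_mod_cast Finset.card_le_card (Finset.erase_subset _ _)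
  · have : normBall M = ∅ := by
      ext z
      simp only [mem_normBall, Finset.notMem_empty, iff_false]
      rintro ⟨hz, hz'⟩
      linarith [one_le_norm hz]
    simp [this]; exact hM

/-- The number of nonzero divisors of `x` of norm less than `Q`. -/
def divCount (Q : ℝ) (x : GaussianInt) : ℕ := ((normBall Q).filter (· ∣ x)).card

lemma norm_mul_cast (a b : GaussianInt) :
    (Zsqrtd.norm (a * b) : ℝ) = Zsqrtd.norm a * Zsqrtd.norm b := by
  rw [Zsqrtd.norm_mul]; push_cast; rfl

lemma divCount_mul_le (Q : ℝ) (a b : GaussianInt) :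
    divCount Q (a * b) ≤ divCount Q a * divCount Q b := by
  unfold divCount
  rw [← Finset.card_product]
  refine le_trans (Finset.card_le_card ?_)
    (Finset.card_image_le (f := fun p : GaussianInt × GaussianInt => p.1 * p.2))
  intro c hc
  rw [Finset.mem_filter, mem_normBall] at hc
  obtain ⟨⟨hc0, hcQ⟩, hcd⟩ := hc
  obtain ⟨c₁, c₂, h₁, h₂, rfl⟩ := exists_dvd_and_dvd_of_dvd_mul hcd
  have h10 : c₁ ≠ 0 := left_ne_zero_of_mul hc0
  have h20 : c₂ ≠ 0 := right_ne_zero_of_mul hc0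
  rw [norm_mul_cast] at hcQ
  have := one_le_norm h10
  have := one_le_norm h20
  rw [Finset.mem_image]
  refine ⟨(c₁, c₂), Finset.mem_product.2 ⟨?_, ?_⟩, rfl⟩ <;>
    simp only [Finset.mem_filter, mem_normBall]
  · exact ⟨⟨h10, by nlinarith⟩, h₁⟩
  · exact ⟨⟨h20, by nlinarith⟩, h₂⟩

lemma one_le_divCount {Q : ℝ} (hQ : 1 < Q) (x : GaussianInt) : 1 ≤ divCount Q x := by
  refine Finset.card_pos.2 ⟨1, ?_⟩
  simp [mem_normBall, hQ]

/-- The multiples of `e` in a norm ball, written as products. -/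
lemma sum_multiples_le {M : ℝ} {e : GaussianInt} (he : e ≠ 0) {g : GaussianInt → ℝ}
    (hg : ∀ z, 0 ≤ g z) :
    ∑ x ∈ (normBall M).filter (e ∣ ·), g x ≤
      ∑ y ∈ normBall (M / Zsqrtd.norm e), g (e * y) := by
  have hinj : Set.InjOn (fun y => e * y) (normBall (M / Zsqrtd.norm e) : Set GaussianInt) :=
    fun _ _ _ _ h => mul_left_cancel₀ he h
  rw [← Finset.sum_image (f := g) hinj]
  refine Finset.sum_le_sum_of_subset_of_nonneg ?_ fun _ _ _ => hg _
  intro x hx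
  rw [Finset.mem_filter, mem_normBall] at hx
  obtain ⟨⟨hx0, hxM⟩, y, rfl⟩ := hx
  rw [Finset.mem_image]
  refine ⟨y, mem_normBall.2 ⟨right_ne_zero_of_mul hx0, ?_⟩, rfl⟩
  rw [norm_mul_cast] at hxM
  rw [lt_div_iff₀ (by linarith [one_le_norm he])]
  linarith

lemma sum_divCount_mul_le (Q M : ℝ) {g : GaussianInt → ℝ} (hg : ∀ z, 0 ≤ g z) :
    ∑ x ∈ normBall M, (divCount Q x : ℝ) * g x ≤
      ∑ e ∈ normBall Q, ∑ y ∈ normBall (M / Zsqrtd.norm e), g (e * y) := by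
  have h : ∀ x, (divCount Q x : ℝ) * g x = ∑ e ∈ normBall Q, if e ∣ x then g x else 0 := by
    intro x
    rw [← Finset.sum_filter, Finset.sum_const, nsmul_eq_mul]
    rfl
  simp_rw [h]
  rw [Finset.sum_comm]
  refine Finset.sum_le_sum fun e he => ?_
  rw [← Finset.sum_filter]
  exact sum_multiples_le (mem_normBall.1 he).1 hg

/-- The logarithmically weighted moments of `divCount`. -/
def divMoment (Q : ℝ) (j : ℕ) : ℝ :=
  ∑ d ∈ normBall Q, (divCount Q d : ℝ) ^ j / Zsqrtd.norm d

lemma norm_cast_nonneg (z : GaussianInt) : (0 : ℝ) ≤ Zsqrtd.norm z := by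
  exact_mod_cast GaussianInt.norm_nonneg z

lemma divMoment_nonneg (Q : ℝ) (j : ℕ) : 0 ≤ divMoment Q j :=
  Finset.sum_nonneg fun d _ => div_nonneg (by positivity) (norm_cast_nonneg d)

lemma divCount_pow_mul_le (Q : ℝ) (j : ℕ) (a b : GaussianInt) :
    (divCount Q (a * b) : ℝ) ^ j ≤ (divCount Q a : ℝ) ^ j * (divCount Q b : ℝ) ^ j := by
  rw [← mul_pow]
  exact_mod_cast Nat.pow_le_pow_left (divCount_mul_le Q a b) j

lemma divMoment_succ_le {Q : ℝ} (hQ : 0 ≤ Q) (j : ℕ) :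
    divMoment Q (j + 1) ≤ divMoment Q j ^ 2 := by
  have h := sum_divCount_mul_le Q Q
    (g := fun d => (divCount Q d : ℝ) ^ j / Zsqrtd.norm d)
    fun d => div_nonneg (by positivity) (norm_cast_nonneg d)
  calc divMoment Q (j + 1)
      = ∑ d ∈ normBall Q, (divCount Q d : ℝ) * ((divCount Q d : ℝ) ^ j / Zsqrtd.norm d) :=
        Finset.sum_congr rfl fun d _ => by ring
    _ ≤ _ := h
    _ ≤ ∑ e ∈ normBall Q, ∑ y ∈ normBall Q,
          ((divCount Q e : ℝ) ^ j / Zsqrtd.norm e) * ((divCount Q y : ℝ) ^ j / Zsqrtd.norm y) := by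
        refine Finset.sum_le_sum fun e he => ?_
        have he0 := (mem_normBall.1 he).1
        have he1 := one_le_norm he0
        have hsub : normBall (Q / Zsqrtd.norm e) ⊆ normBall Q := by
          intro y hy
          rw [mem_normBall] at hy ⊢
          exact ⟨hy.1, hy.2.trans_le (div_le_self hQ he1)⟩
        refine (Finset.sum_le_sum fun y hy => ?_).trans
          (Finset.sum_le_sum_of_subset_of_nonneg hsub fun y _ _ =>
            mul_nonneg (div_nonneg (by positivity) (norm_cast_nonneg e))
              (div_nonneg (by positivity) (norm_cast_nonneg y)))
        have hy0 := (mem_normBall.1 hy).1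
        have hy1 := one_le_norm hy0
        rw [norm_mul_cast, div_mul_div_comm]
        gcongr
        exact divCount_pow_mul_le Q j e y
    _ = divMoment Q j ^ 2 := by
        rw [sq, divMoment, Finset.sum_mul_sum]

lemma divMoment_le {Q : ℝ} (hQ : 0 ≤ Q) (j : ℕ) : divMoment Q j ≤ divMoment Q 0 ^ 2 ^ j := by
  induction j with
  | zero => simp
  | succ j ih =>
    refine (divMoment_succ_le hQ j).trans ?_
    rw [pow_succ 2 j, pow_mul]
    exact pow_le_pow_left₀ (divMoment_nonneg Q j) ih 2

lemma one_le_divMoment_zero {Q : ℝ} (hQ : 1 < Q) : 1 ≤ divMoment Q 0 := by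
  have h1 : (1 : GaussianInt) ∈ normBall Q := by simp [mem_normBall, hQ]
  have := Finset.single_le_sum (f := fun d : GaussianInt => (divCount Q d : ℝ) ^ 0 / Zsqrtd.norm d)
    (fun d _ => div_nonneg (by positivity) (norm_cast_nonneg d)) h1
  simpa [divMoment] using this

lemma sum_divCount_pow_le {Q : ℝ} (hQ : 1 < Q) (j : ℕ) {M : ℝ} (hM : 0 ≤ M) :
    ∑ x ∈ normBall M, (divCount Q x : ℝ) ^ j ≤ 9 * divMoment Q 0 ^ 2 ^ j * M := by
  have hG := one_le_divMoment_zero hQ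
  induction j generalizing M with
  | zero =>
    have := card_normBall_le hM
    simp only [pow_zero, Finset.sum_const, nsmul_eq_mul, mul_one, pow_one]
    nlinarith
  | succ j ih =>
    have h := sum_divCount_mul_le Q M (g := fun x => (divCount Q x : ℝ) ^ j)
      fun x => by positivity
    calc ∑ x ∈ normBall M, (divCount Q x : ℝ) ^ (j + 1)
        = ∑ x ∈ normBall M, (divCount Q x : ℝ) * (divCount Q x : ℝ) ^ j :=
          Finset.sum_congr rfl fun x _ => pow_succ' _ _
      _ ≤ _ := h
      _ ≤ ∑ e ∈ normBall Q, (divCount Q e : ℝ) ^ j *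
            (9 * divMoment Q 0 ^ 2 ^ j * (M / Zsqrtd.norm e)) := by
          refine Finset.sum_le_sum fun e _ => ?_
          refine (Finset.sum_le_sum fun y _ => divCount_pow_mul_le Q j e y).trans ?_
          rw [← Finset.mul_sum]
          exact mul_le_mul_of_nonneg_left (ih (div_nonneg hM (norm_cast_nonneg e)))
            (by positivity)
      _ = 9 * divMoment Q 0 ^ 2 ^ j * M * divMoment Q j := by
          rw [divMoment.eq_1 Q j, Finset.mul_sum]
          exact Finset.sum_congr rfl fun e _ => by ring
      _ ≤ 9 * divMoment Q 0 ^ 2 ^ j * M * divMoment Q 0 ^ 2 ^ j := by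
          have := divMoment_le (by linarith : (0 : ℝ) ≤ Q) j
          gcongr
      _ = _ := by rw [pow_succ 2 j, pow_mul]; ring

lemma summable_norm_rpow {δ : ℝ} (hδ : 0 < δ) :
    Summable fun z : GaussianInt => (Zsqrtd.norm z : ℝ) ^ (-(1 + δ)) := by
  have hs := EisensteinSeries.summable_one_div_norm_rpow (k := 2 + 2 * δ) (by linarith)
  have hinj : Function.Injective fun z : GaussianInt => ![z.re, z.im] := by
    intro a b h
    have h0 := congrFun h 0
    have h1 := congrFun h 1
    exact Zsqrtd.ext (by simpa using h0) (by simpa using h1)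
  refine Summable.of_nonneg_of_le (fun z => Real.rpow_nonneg (norm_cast_nonneg z) _)
    (fun z => ?_) (hs.comp_injective hinj)
  simp only [Function.comp_apply]
  by_cases hz : z = 0
  · subst hz
    have h1 : -(1 + δ) ≠ 0 := by linarith
    rw [Zsqrtd.norm_zero, Int.cast_zero, Real.zero_rpow h1]
    positivity
  have hv : ‖![z.re, z.im]‖ ^ 2 ≤ (Zsqrtd.norm z : ℝ) := by
    have hle : ‖![z.re, z.im]‖ ≤ √(Zsqrtd.norm z : ℝ) := by
      refine (pi_norm_le_iff_of_nonneg (Real.sqrt_nonneg _)).2 fun i => ?_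
      rw [Int.norm_eq_abs]
      apply Real.abs_le_sqrt
      rw [Zsqrtd.norm_def]
      push_cast
      fin_cases i <;> simp <;>
        nlinarith [mul_self_nonneg (z.re : ℝ), mul_self_nonneg (z.im : ℝ)]
    calc _ ≤ √(Zsqrtd.norm z : ℝ) ^ 2 := pow_le_pow_left₀ (_root_.norm_nonneg _) hle 2
      _ = _ := Real.sq_sqrt (norm_cast_nonneg z)
  have hpos : 0 < ‖![z.re, z.im]‖ := by
    rw [_root_.norm_pos_iff]
    intro h
    exact hz (hinj (h.trans (by ext i; fin_cases i <;> simp)))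
  have he : ‖![z.re, z.im]‖ ^ (-(2 + 2 * δ)) = (‖![z.re, z.im]‖ ^ 2) ^ (-(1 + δ)) := by
    rw [← Real.rpow_natCast, ← Real.rpow_mul hpos.le]
    congr 1; push_cast; ring
  rw [he]
  exact Real.rpow_le_rpow_of_nonpos (by positivity) hv (by linarith)

lemma divMoment_zero_le {δ : ℝ} (hδ : 0 < δ) :
    ∃ Z : ℝ, 0 ≤ Z ∧ ∀ Q : ℝ, 0 ≤ Q → divMoment Q 0 ≤ Z * Q ^ δ := by
  have hs := summable_norm_rpow hδ
  have hnn : ∀ z : GaussianInt, (0 : ℝ) ≤ (Zsqrtd.norm z : ℝ) ^ (-(1 + δ)) :=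
    fun z => Real.rpow_nonneg (norm_cast_nonneg z) _
  refine ⟨∑' z : GaussianInt, (Zsqrtd.norm z : ℝ) ^ (-(1 + δ)), tsum_nonneg hnn, fun Q hQ0 => ?_⟩
  calc divMoment Q 0 ≤ ∑ d ∈ normBall Q, (Zsqrtd.norm d : ℝ) ^ (-(1 + δ)) * Q ^ δ := by
        refine Finset.sum_le_sum fun d hd => ?_
        rw [mem_normBall] at hd
        have hd1 := one_le_norm hd.1
        have hd0 : (0 : ℝ) < Zsqrtd.norm d := by linarith
        calc (divCount Q d : ℝ) ^ 0 / Zsqrtd.norm d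
            = (Zsqrtd.norm d : ℝ) ^ (-(1 + δ)) * (Zsqrtd.norm d : ℝ) ^ δ := by
              rw [← Real.rpow_add hd0, pow_zero, one_div, ← Real.rpow_neg_one]
              congr 1; ring
          _ ≤ _ := mul_le_mul_of_nonneg_left
              (Real.rpow_le_rpow hd0.le hd.2.le hδ.le) (hnn d)
    _ = (∑ d ∈ normBall Q, (Zsqrtd.norm d : ℝ) ^ (-(1 + δ))) * Q ^ δ := by
        rw [Finset.sum_mul]
    _ ≤ _ := mul_le_mul_of_nonneg_right (hs.sum_le_tsum _ fun z _ => hnn z)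
        (Real.rpow_nonneg hQ0 δ)

/-! ### Complete exponential sums modulo `q` -/

lemma mem_Bq_iff {q r : GaussianInt} : r ∈ Bq q ↔
    (0 ≤ (r * star q).re ∧ (r * star q).re < Zsqrtd.norm q) ∧
      (0 ≤ (r * star q).im ∧ (r * star q).im < Zsqrtd.norm q) := by
  have h1 : cip (toComplex r) (toComplex q) = (((r * star q).re : ℤ) : ℝ) := by
    rw [cip, ← GaussianInt.intCast_re, ← GaussianInt.intCast_re, ← GaussianInt.intCast_im, ← GaussianInt.intCast_im, Zsqrtd.re_mul,
      Zsqrtd.re_star, Zsqrtd.im_star]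
    push_cast; ring
  have h2 : cip (toComplex r) (Complex.I * toComplex q) = (((r * star q).im : ℤ) : ℝ) := by
    rw [cip, Complex.I_mul_re, Complex.I_mul_im, ← GaussianInt.intCast_re, ← GaussianInt.intCast_re, ← GaussianInt.intCast_im,
      ← GaussianInt.intCast_im, Zsqrtd.im_mul, Zsqrtd.re_star, Zsqrtd.im_star]
    push_cast; ring
  rw [Bq, Set.mem_ofPred_eq, h1, h2, ← GaussianInt.intCast_real_norm]
  norm_cast
  tauto

/-- The representative of `n` modulo `q` in the box `Bq q`. -/
def boxRed (q n : GaussianInt) : GaussianInt :=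
  n - q * ⟨(n * star q).re / Zsqrtd.norm q, (n * star q).im / Zsqrtd.norm q⟩

lemma boxRed_mul_star (q n : GaussianInt) :
    boxRed q n * star q =
      ⟨(n * star q).re % Zsqrtd.norm q, (n * star q).im % Zsqrtd.norm q⟩ := by
  have h : boxRed q n * star q = n * star q - (Zsqrtd.norm q : GaussianInt) *
      ⟨(n * star q).re / Zsqrtd.norm q, (n * star q).im / Zsqrtd.norm q⟩ := by
    rw [Zsqrtd.norm_eq_mul_conj, boxRed]; ring
  rw [h]
  ext
  · simp [Int.emod_def]
  · simp [Int.emod_def]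

lemma boxRed_mem {q : GaussianInt} (hq : q ≠ 0) (n : GaussianInt) : boxRed q n ∈ Bq q := by
  have h := GaussianInt.norm_pos.2 hq
  rw [mem_Bq_iff, boxRed_mul_star]
  exact ⟨⟨Int.emod_nonneg _ h.ne', Int.emod_lt_of_pos _ h⟩,
    Int.emod_nonneg _ h.ne', Int.emod_lt_of_pos _ h⟩

lemma boxRed_add_mul {q : GaussianInt} (hq : q ≠ 0) (n t : GaussianInt) :
    boxRed q (n + q * t) = boxRed q n := by
  have h := GaussianInt.norm_pos.2 hq
  have hs : star q ≠ 0 := star_ne_zero.2 hq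
  apply mul_right_cancel₀ hs
  have e : (n + q * t) * star q = n * star q + (Zsqrtd.norm q : GaussianInt) * t := by
    rw [Zsqrtd.norm_eq_mul_conj]; ring
  rw [boxRed_mul_star, boxRed_mul_star, e]
  ext <;> simp

lemma boxRed_eq_self {q r : GaussianInt} (hq : q ≠ 0) (hr : r ∈ Bq q) : boxRed q r = r := by
  rw [mem_Bq_iff] at hr
  have hs : star q ≠ 0 := star_ne_zero.2 hq
  apply mul_right_cancel₀ hs
  rw [boxRed_mul_star, Int.emod_eq_of_lt hr.1.1 hr.1.2, Int.emod_eq_of_lt hr.2.1 hr.2.2]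

lemma norm_lt_of_mem_Bq {q r : GaussianInt} (hq : q ≠ 0) (hr : r ∈ Bq q) :
    (Zsqrtd.norm r : ℝ) < 2 * Zsqrtd.norm q := by
  have h := GaussianInt.norm_pos.2 hq
  rw [mem_Bq_iff] at hr
  have e : Zsqrtd.norm r * Zsqrtd.norm q =
      (r * star q).re * (r * star q).re + (r * star q).im * (r * star q).im := by
    rw [← Zsqrtd.norm_conj q, ← Zsqrtd.norm_mul, Zsqrtd.norm_def]; ring
  obtain ⟨⟨h1, h2⟩, h3, h4⟩ := hr
  have : Zsqrtd.norm r * Zsqrtd.norm q < 2 * Zsqrtd.norm q * Zsqrtd.norm q := by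
    rw [e]; nlinarith
  exact_mod_cast lt_of_mul_lt_mul_right this h.le

lemma finite_Bq {q : GaussianInt} (hq : q ≠ 0) : (Bq q).Finite :=
  (finite_norm_lt (2 * Zsqrtd.norm q)).subset fun _ hr => norm_lt_of_mem_Bq hq hr

lemma card_Bq_le {q : GaussianInt} (hq : q ≠ 0) :
    ((finite_Bq hq).toFinset.card : ℝ) ≤ 18 * Zsqrtd.norm q := by
  have h1 := one_le_norm hq
  have h := card_norm_lt_le (M := 2 * Zsqrtd.norm q) (by linarith)
  have hsub : (finite_Bq hq).toFinset ⊆ (finite_norm_lt (2 * Zsqrtd.norm q)).toFinset := by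
    intro r hr
    simpa using norm_lt_of_mem_Bq hq (by simpa using hr)
  have h2 : ((finite_Bq hq).toFinset.card : ℝ) ≤
      ((finite_norm_lt (2 * Zsqrtd.norm q)).toFinset.card : ℝ) := by
    exact_mod_cast Finset.card_le_card hsub
  linarith

/-- The additive character `n ↦ e(⟨x, n/q⟩)`. -/
def addPhase (q x n : GaussianInt) : ℂ :=
  e2 (cip (toComplex x) (toComplex n / toComplex q))

lemma e2_add (s t : ℝ) : e2 (s + t) = e2 s * e2 t := by
  simp only [e2]
  rw [← Complex.exp_add]
  congr 1; push_cast; ring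

lemma norm_e2 (t : ℝ) : ‖e2 t‖ = 1 := by
  rw [e2, Complex.norm_exp]
  simp

lemma e2_eq_one_iff {t : ℝ} : e2 t = 1 ↔ ∃ n : ℤ, t = n := by
  rw [e2, Complex.exp_eq_one_iff]
  refine exists_congr fun n => ?_
  have hpi : (2 * Real.pi * Complex.I : ℂ) ≠ 0 := Complex.two_pi_I_ne_zero
  rw [mul_comm (n : ℂ), mul_right_inj' hpi]
  exact_mod_cast Iff.rfl

lemma norm_addPhase (q x n : GaussianInt) : ‖addPhase q x n‖ = 1 := norm_e2 _

lemma addPhase_add (q x m n : GaussianInt) :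
    addPhase q x (m + n) = addPhase q x m * addPhase q x n := by
  rw [addPhase, addPhase, addPhase, ← e2_add]
  congr 1
  rw [toComplex_add, add_div, cip, cip, cip, Complex.add_re, Complex.add_im]
  ring

lemma addPhase_mul_left {q : GaussianInt} (hq : q ≠ 0) (x t : GaussianInt) :
    addPhase q x (q * t) = 1 := by
  have hq' : toComplex q ≠ 0 := by simpa using hq
  rw [addPhase, toComplex_mul, mul_div_cancel_left₀ _ hq', e2_eq_one_iff]
  refine ⟨x.re * t.re + x.im * t.im, ?_⟩
  rw [cip, ← GaussianInt.intCast_re, ← GaussianInt.intCast_re, ← GaussianInt.intCast_im, ← GaussianInt.intCast_im]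
  push_cast; rfl

lemma addPhase_boxRed {q : GaussianInt} (hq : q ≠ 0) (x n : GaussianInt) :
    addPhase q x (boxRed q n) = addPhase q x n := by
  have h : n = boxRed q n +
      q * ⟨(n * star q).re / Zsqrtd.norm q, (n * star q).im / Zsqrtd.norm q⟩ := by
    rw [boxRed]; ring
  conv_rhs => rw [h, addPhase_add, addPhase_mul_left hq, mul_one]

/-- The complete exponential sum over the box `Bq q`. -/
def boxSum (q x : GaussianInt) : ℂ := ∑' n : Bq q, addPhase q x n

lemma boxSum_eq {q : GaussianInt} (hq : q ≠ 0) (x : GaussianInt) :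
    boxSum q x = ∑ n ∈ (finite_Bq hq).toFinset, addPhase q x n := by
  rw [boxSum, ← Finset.tsum_subtype', Set.Finite.coe_toFinset]

lemma norm_boxSum_le {q : GaussianInt} (hq : q ≠ 0) (x : GaussianInt) :
    ‖boxSum q x‖ ≤ 18 * Zsqrtd.norm q := by
  rw [boxSum_eq hq]
  refine (norm_sum_le _ _).trans ?_
  simp only [norm_addPhase, Finset.sum_const, nsmul_eq_mul, mul_one]
  exact card_Bq_le hq

lemma addPhase_mul_boxSum {q : GaussianInt} (hq : q ≠ 0) (x t : GaussianInt) :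
    addPhase q x t * boxSum q x = boxSum q x := by
  rw [boxSum_eq hq, Finset.mul_sum]
  have inv : ∀ s n : GaussianInt, n ∈ Bq q → boxRed q (boxRed q (n + s) - s) = n := by
    intro s n hn
    have : boxRed q (n + s) - s = n +
        q * -⟨((n + s) * star q).re / Zsqrtd.norm q, ((n + s) * star q).im / Zsqrtd.norm q⟩ := by
      rw [boxRed]; ring
    rw [this, boxRed_add_mul hq, boxRed_eq_self hq hn]
  refine Finset.sum_nbij' (fun n => boxRed q (n + t)) (fun n => boxRed q (n - t)) ?_ ?_ ?_ ?_ ?_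
  · intro n _; simpa using boxRed_mem hq _
  · intro n _; simpa using boxRed_mem hq _
  · intro n hn; exact inv t n (by simpa using hn)
  · intro n hn
    have := inv (-t) n (by simpa using hn)
    simpa [sub_eq_add_neg] using this
  · intro n _
    rw [addPhase_boxRed hq, addPhase_add, mul_comm]

lemma dvd_star_of_boxSum_ne_zero {q x : GaussianInt} (hq : q ≠ 0) (h : boxSum q x ≠ 0) :
    q ∣ star x := by
  have hp : ∀ t, addPhase q x t = 1 := fun t =>
    (mul_eq_right₀ h).1 (addPhase_mul_boxSum hq x t)
  have hq' : toComplex q ≠ 0 := by simpa using hq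
  obtain ⟨a, ha⟩ := e2_eq_one_iff.1 (hp 1)
  obtain ⟨b, hb⟩ := e2_eq_one_iff.1 (hp ⟨0, 1⟩)
  refine ⟨⟨a, -b⟩, ?_⟩
  rw [← toComplex_inj, toComplex_mul, mul_comm, ← div_eq_iff hq', toComplex_star]
  have h1 : toComplex (1 : GaussianInt) / toComplex q = (toComplex q)⁻¹ := by simp
  have h2 : toComplex (⟨0, 1⟩ : GaussianInt) / toComplex q = Complex.I * (toComplex q)⁻¹ := by
    rw [toComplex_def]; simp [div_eq_mul_inv]
  rw [h1] at ha
  rw [h2] at hb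
  rw [div_eq_mul_inv]
  generalize (toComplex q)⁻¹ = w at ha hb ⊢
  rw [cip] at ha hb
  rw [Complex.I_mul_re, Complex.I_mul_im] at hb
  apply Complex.ext
  · rw [re_toComplex, Complex.mul_re, Complex.conj_re, Complex.conj_im, ← ha]
    ring
  · rw [im_toComplex, Complex.mul_im, Complex.conj_re, Complex.conj_im]
    push_cast
    rw [← hb]
    ring

/-! ### The divisor bound for Ramanujan sums -/

lemma mul_mem_Bq_iff {d c m : GaussianInt} (hd : d ≠ 0) : d * m ∈ Bq (d * c) ↔ m ∈ Bq c := by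
  have h := GaussianInt.norm_pos.2 hd
  have e : d * m * star (d * c) = (Zsqrtd.norm d : GaussianInt) * (m * star c) := by
    rw [Zsqrtd.norm_eq_mul_conj, star_mul]; ring
  rw [mem_Bq_iff, mem_Bq_iff, e, Zsqrtd.norm_mul, Zsqrtd.re_smul, Zsqrtd.im_smul,
    mul_nonneg_iff_of_pos_left h, mul_nonneg_iff_of_pos_left h, mul_lt_mul_iff_right₀ h,
    mul_lt_mul_iff_right₀ h]

lemma addPhase_mul_mul {d : GaussianInt} (hd : d ≠ 0) (c x m : GaussianInt) :
    addPhase (d * c) x (d * m) = addPhase c x m := by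
  have hd' : toComplex d ≠ 0 := by simpa using hd
  rw [addPhase, addPhase, toComplex_mul, toComplex_mul, mul_div_mul_left _ _ hd']

lemma sum_multiples_addPhase {d c : GaussianInt} (hq : d * c ≠ 0) (x : GaussianInt) :
    ∑ n ∈ (finite_Bq hq).toFinset.filter (d ∣ ·), addPhase (d * c) x n = boxSum c x := by
  have hd := left_ne_zero_of_mul hq
  have hc := right_ne_zero_of_mul hq
  rw [boxSum_eq hc]
  symm
  refine Finset.sum_bij (fun m _ => d * m) ?_ ?_ ?_ ?_
  · intro m hm
    simp only [Finset.mem_filter, Set.Finite.mem_toFinset] at hm ⊢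
    exact ⟨(mul_mem_Bq_iff hd).2 hm, dvd_mul_right _ _⟩
  · intro a _ b _ h
    exact mul_left_cancel₀ hd h
  · intro n hn
    simp only [Finset.mem_filter, Set.Finite.mem_toFinset] at hn
    obtain ⟨hn, m, rfl⟩ := hn
    exact ⟨m, by simpa using (mul_mem_Bq_iff hd).1 hn, rfl⟩
  · intro m _
    exact (addPhase_mul_mul hd c x m).symm

/-- A set of representatives of the prime divisors of `q` up to associates. -/
lemma exists_prime_divisors {q : GaussianInt} (hq : q ≠ 0) :
    ∃ P : Finset GaussianInt, (∀ p ∈ P, Prime p) ∧ (∀ p ∈ P, p ∣ q) ∧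
      (∀ p ∈ P, ∀ p' ∈ P, p ∣ p' → p = p') ∧
      ∀ r, Irreducible r → r ∣ q → ∃ p ∈ P, p ∣ r := by
  let _ : NormalizationMonoid GaussianInt :=
    (UniqueFactorizationMonoid.strongNormalizationMonoid (α := GaussianInt)).toNormalizationMonoid
  refine ⟨(UniqueFactorizationMonoid.normalizedFactors q).toFinset, ?_, ?_, ?_, ?_⟩
  · intro p hp
    exact UniqueFactorizationMonoid.prime_of_normalized_factor p (Multiset.mem_toFinset.1 hp)
  · intro p hp
    exact UniqueFactorizationMonoid.dvd_of_mem_normalizedFactors (Multiset.mem_toFinset.1 hp)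
  · intro p hp p' hp' h
    exact UniqueFactorizationMonoid.normalizedFactors_eq_of_dvd q p (Multiset.mem_toFinset.1 hp)
      p' (Multiset.mem_toFinset.1 hp') h
  · intro r hr hrq
    obtain ⟨p, hp, hpr⟩ :=
      UniqueFactorizationMonoid.exists_mem_normalizedFactors_of_dvd hq hr hrq
    exact ⟨p, Multiset.mem_toFinset.2 hp, hpr.symm.dvd⟩

lemma prod_dvd_iff_of_primes {P S : Finset GaussianInt} (hprime : ∀ p ∈ P, Prime p)
    (hinj : ∀ p ∈ P, ∀ p' ∈ P, p ∣ p' → p = p') (hS : S ⊆ P) (n : GaussianInt) :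
    ∏ p ∈ S, p ∣ n ↔ ∀ p ∈ S, p ∣ n := by
  refine ⟨fun h p hp => (Finset.dvd_prod_of_mem _ hp).trans h, fun h => ?_⟩
  refine Finset.prod_dvd_of_isRelPrime (fun p hp p' hp' hne => ?_) h
  refine ((hprime p (hS hp)).irreducible.isRelPrime_iff_not_dvd).2 fun hd => ?_
  exact hne (hinj p (hS hp) p' (hS hp') hd)

lemma coprime_indicator_eq {q : GaussianInt} (hq : q ≠ 0) {P : Finset GaussianInt}
    (hprime : ∀ p ∈ P, Prime p) (hdvd : ∀ p ∈ P, p ∣ q)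
    (hinj : ∀ p ∈ P, ∀ p' ∈ P, p ∣ p' → p = p')
    (hcover : ∀ r, Irreducible r → r ∣ q → ∃ p ∈ P, p ∣ r) (n : GaussianInt) :
    (if IsUnit (EuclideanDomain.gcd n q) then (1 : ℂ) else 0) =
      ∑ S ∈ P.powerset, (-1) ^ S.card * if ∏ p ∈ S, p ∣ n then 1 else 0 := by
  have h1 : (if IsUnit (EuclideanDomain.gcd n q) then (1 : ℂ) else 0) =
      ∏ p ∈ P, (1 - if p ∣ n then 1 else 0) := by
    split_ifs with hu
    · symm
      refine Finset.prod_eq_one fun p hp => ?_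
      rw [if_neg, sub_zero]
      intro hpn
      exact (hprime p hp).not_isUnit
        (isUnit_of_dvd_unit (EuclideanDomain.dvd_gcd hpn (hdvd p hp)) hu)
    · have hg : EuclideanDomain.gcd n q ≠ 0 := fun h =>
        hq (EuclideanDomain.gcd_eq_zero_iff.1 h).2
      obtain ⟨r, hr, hrg⟩ := WfDvdMonoid.exists_irreducible_factor hu hg
      obtain ⟨p, hp, hpr⟩ := hcover r hr (hrg.trans (EuclideanDomain.gcd_dvd_right n q))
      symm
      refine Finset.prod_eq_zero hp ?_
      rw [if_pos (hpr.trans (hrg.trans (EuclideanDomain.gcd_dvd_left n q))), sub_self]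
  rw [h1, Finset.prod_sub]
  refine Finset.sum_congr rfl fun S hS => ?_
  rw [Finset.prod_const_one, mul_one]
  congr 1
  have hi := prod_dvd_iff_of_primes hprime hinj (Finset.mem_powerset.1 hS) n
  by_cases h : ∏ p ∈ S, p ∣ n
  · rw [if_pos h]
    exact Finset.prod_eq_one fun p hp => if_pos (hi.1 h p hp)
  · rw [if_neg h]
    have : ∃ p ∈ S, ¬ p ∣ n := by
      by_contra hc
      push Not at hc
      exact h (hi.2 hc)
    obtain ⟨p, hp, hpn⟩ := this
    exact Finset.prod_eq_zero hp (if_neg hpn)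

lemma gtau_eq_sum {q : GaussianInt} (hq : q ≠ 0) (x : GaussianInt) :
    gtau q x = ∑ n ∈ (finite_Bq hq).toFinset,
      (if IsUnit (EuclideanDomain.gcd n q) then (1 : ℂ) else 0) * addPhase q x n := by
  have hA : (Aq q).Finite := (finite_Bq hq).subset fun _ h => h.1
  have h1 : gtau q x = ∑ n ∈ hA.toFinset, addPhase q x n := by
    rw [gtau, ← Finset.tsum_subtype', Set.Finite.coe_toFinset]
    rfl
  have h2 : hA.toFinset = (finite_Bq hq).toFinset.filter
      fun n => IsUnit (EuclideanDomain.gcd n q) := by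
    ext n
    simp [Aq]
  rw [h1, h2, Finset.sum_filter]
  exact Finset.sum_congr rfl fun n _ => by split_ifs <;> simp

lemma norm_gtau_le {q : GaussianInt} {Q : ℝ} (hq : q ∈ normBall Q) (x : GaussianInt) :
    ‖gtau q x‖ ≤
      ∑ d ∈ normBall Q, if d ∣ q ∧ d ∣ star x then 18 * (Zsqrtd.norm d : ℝ) else 0 := by
  obtain ⟨hq0, hqQ⟩ := mem_normBall.1 hq
  obtain ⟨P, hprime, hdvd, hinj, hcover⟩ := exists_prime_divisors hq0
  have hprod : ∀ S ∈ P.powerset, ∏ p ∈ S, p ∣ q := fun S hS =>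
    (prod_dvd_iff_of_primes hprime hinj (Finset.mem_powerset.1 hS) q).2
      fun p hp => hdvd p (Finset.mem_powerset.1 hS hp)
  have hmul : ∀ S ∈ P.powerset, (∏ p ∈ S, p) * (q / ∏ p ∈ S, p) = q := fun S hS =>
    EuclideanDomain.mul_div_cancel' (ne_zero_of_dvd_ne_zero hq0 (hprod S hS)) (hprod S hS)
  have hsub : ∀ S ∈ P.powerset, ∀ T ∈ P.powerset, ∏ p ∈ S, p ∣ ∏ p ∈ T, p → S ⊆ T := by
    intro S hS T hT h p hp
    have hpP := Finset.mem_powerset.1 hS hp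
    obtain ⟨p', hp', hpp'⟩ := ((hprime p hpP).dvd_finsetProd_iff _).1
      ((Finset.dvd_prod_of_mem _ hp).trans h)
    rwa [hinj p hpP p' (Finset.mem_powerset.1 hT hp') hpp']
  have hcinj : Set.InjOn (fun S : Finset GaussianInt => q / ∏ p ∈ S, p)
      (P.powerset : Set (Finset GaussianInt)) := by
    intro S hS T hT h
    dsimp only at h
    have e : ∏ p ∈ S, p = ∏ p ∈ T, p := by
      have h1 := hmul S hS
      have h2 := hmul T hT
      rw [h] at h1
      exact mul_right_cancel₀ (right_ne_zero_of_mul (h2.trans_ne hq0)) (h1.trans h2.symm)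
    exact (hsub S hS T hT e.dvd).antisymm (hsub T hT S hS e.symm.dvd)
  have hsum : gtau q x = ∑ S ∈ P.powerset, (-1) ^ S.card * boxSum (q / ∏ p ∈ S, p) x := by
    rw [gtau_eq_sum hq0]
    simp_rw [coprime_indicator_eq hq0 hprime hdvd hinj hcover, Finset.sum_mul]
    rw [Finset.sum_comm]
    refine Finset.sum_congr rfl fun S hS => ?_
    have hne : (∏ p ∈ S, p) * (q / ∏ p ∈ S, p) ≠ 0 := (hmul S hS).trans_ne hq0
    have := sum_multiples_addPhase hne x
    simp only [hmul S hS] at this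
    rw [← this, Finset.mul_sum, Finset.sum_filter]
    exact Finset.sum_congr rfl fun n _ => by split_ifs <;> simp
  have hbox : ∀ d : GaussianInt, d ≠ 0 →
      ‖boxSum d x‖ ≤ if d ∣ star x then 18 * (Zsqrtd.norm d : ℝ) else 0 := by
    intro d hd
    split_ifs with h
    · exact norm_boxSum_le hd x
    · have : boxSum d x = 0 := by
        by_contra hne
        exact h (dvd_star_of_boxSum_ne_zero hd hne)
      simp [this]
  calc ‖gtau q x‖ ≤ ∑ S ∈ P.powerset, ‖boxSum (q / ∏ p ∈ S, p) x‖ := by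
        rw [hsum]
        refine (norm_sum_le _ _).trans (Finset.sum_le_sum fun S _ => ?_)
        simp
    _ = ∑ d ∈ P.powerset.image (fun S => q / ∏ p ∈ S, p), ‖boxSum d x‖ :=
        (Finset.sum_image (f := fun d => ‖boxSum d x‖) hcinj).symm
    _ ≤ ∑ d ∈ (normBall Q).filter (· ∣ q), ‖boxSum d x‖ := by
        refine Finset.sum_le_sum_of_subset_of_nonneg ?_ fun _ _ _ => _root_.norm_nonneg _
        intro d hd
        obtain ⟨S, hS, rfl⟩ := Finset.mem_image.1 hd
        have hm := hmul S hS
        have hne : (∏ p ∈ S, p) * (q / ∏ p ∈ S, p) ≠ 0 := hm.trans_ne hq0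
        have hc := right_ne_zero_of_mul hne
        have h1 := one_le_norm (left_ne_zero_of_mul hne)
        have h2 := one_le_norm hc
        have h3 : (Zsqrtd.norm q : ℝ) = _ := (congrArg (fun z => (Zsqrtd.norm z : ℝ)) hm.symm).trans
          (norm_mul_cast _ _)
        rw [Finset.mem_filter, mem_normBall]
        exact ⟨⟨hc, by nlinarith⟩, ⟨_, by rw [mul_comm]; exact hm.symm⟩⟩
    _ ≤ ∑ d ∈ (normBall Q).filter (· ∣ q),
          if d ∣ star x then 18 * (Zsqrtd.norm d : ℝ) else 0 :=
        Finset.sum_le_sum fun d hd => hbox d (mem_normBall.1 (Finset.mem_filter.1 hd).1).1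
    _ = _ := by
        rw [Finset.sum_filter]
        refine Finset.sum_congr rfl fun d _ => ?_
        by_cases h1 : d ∣ q <;> by_cases h2 : d ∣ star x <;> simp [h1, h2]

lemma sum_norm_gtau_le {Q : ℝ} (hQ : 0 ≤ Q) (x : GaussianInt) :
    ∑ q ∈ normBall Q, ‖gtau q x‖ ≤ 162 * Q * divCount Q (star x) := by
  refine (Finset.sum_le_sum fun q hq => norm_gtau_le hq x).trans ?_
  rw [Finset.sum_comm]
  have h : ∀ d ∈ normBall Q,
      (∑ q ∈ normBall Q, if d ∣ q ∧ d ∣ star x then 18 * (Zsqrtd.norm d : ℝ) else 0) ≤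
        if d ∣ star x then 162 * Q else 0 := by
    intro d hd
    have hd0 := (mem_normBall.1 hd).1
    have hd1 := one_le_norm hd0
    by_cases hx : d ∣ star x
    · simp only [hx, and_true, if_true]
      rw [← Finset.sum_filter]
      refine (sum_multiples_le hd0 (g := fun _ => 18 * (Zsqrtd.norm d : ℝ))
        fun _ => by positivity).trans ?_
      rw [Finset.sum_const, nsmul_eq_mul]
      have hc := card_normBall_le (M := Q / Zsqrtd.norm d) (by positivity)
      calc _ ≤ 9 * (Q / Zsqrtd.norm d) * (18 * (Zsqrtd.norm d : ℝ)) := by gcongr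
        _ = 162 * Q := by field_simp; ring
    · simp [hx]
  refine (Finset.sum_le_sum h).trans ?_
  rw [← Finset.sum_filter, Finset.sum_const, nsmul_eq_mul, divCount, mul_comm]

lemma divCount_zero_le {Q : ℝ} (hQ : 0 ≤ Q) : (divCount Q 0 : ℝ) ≤ 9 * Q := by
  simpa [divCount] using card_normBall_le hQ

lemma divCount_star (Q : ℝ) (x : GaussianInt) : divCount Q (star x) = divCount Q x := by
  have h : ∀ y : GaussianInt, divCount Q y ≤ divCount Q (star y) := by
    intro y
    refine Finset.card_le_card_of_injOn star ?_ (star_injective.injOn)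
    intro d hd
    simp only [Finset.coe_filter, Set.mem_ofPred_eq, mem_normBall] at hd ⊢
    refine ⟨⟨star_ne_zero.2 hd.1.1, ?_⟩, ?_⟩
    · rw [Zsqrtd.norm_conj]; exact hd.1.2
    · obtain ⟨c, rfl⟩ := hd.2
      rw [star_mul]
      exact dvd_mul_left _ _
  refine le_antisymm ?_ (h x)
  simpa using h (star x)

/-! ### The moment bound -/

lemma tsum_norm_gtau_le {Q : ℝ} (hQ : 0 ≤ Q) (x : GaussianInt) :
    ∑' q : {q : GaussianInt // IsCanon q ∧ (Zsqrtd.norm q : ℝ) < Q}, ‖gtau (q : GaussianInt) x‖ ≤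
      162 * Q * divCount Q x := by
  have hset : {q : GaussianInt | IsCanon q ∧ (Zsqrtd.norm q : ℝ) < Q} =
      ((normBall Q).filter IsCanon : Finset GaussianInt) := by
    ext q
    simp only [Set.mem_ofPred_eq, Finset.coe_filter, mem_normBall]
    refine ⟨fun h => ⟨⟨?_, h.2⟩, h.1⟩, fun h => ⟨h.2, h.1.2⟩⟩
    rintro rfl
    exact absurd h.1.1 (by simp)
  have h : ∑' q : {q : GaussianInt // IsCanon q ∧ (Zsqrtd.norm q : ℝ) < Q},
      ‖gtau (q : GaussianInt) x‖ = ∑ q ∈ (normBall Q).filter IsCanon, ‖gtau q x‖ := by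
    rw [← Finset.tsum_subtype', ← hset]
    rfl
  rw [h, ← divCount_star]
  refine le_trans ?_ (sum_norm_gtau_le hQ x)
  exact Finset.sum_le_sum_of_subset_of_nonneg (Finset.filter_subset _ _)
    fun _ _ _ => _root_.norm_nonneg _

lemma tsum_norm_lt_eq (N : ℕ) (f : GaussianInt → ℝ) (hN : 0 < N) :
    ∑' x : {x : GaussianInt // Zsqrtd.norm x < (N : ℤ)}, f x = f 0 + ∑ x ∈ normBall N, f x := by
  have hset : {x : GaussianInt | Zsqrtd.norm x < (N : ℤ)} =
      ((finite_norm_lt N).toFinset : Finset GaussianInt) := by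
    ext x
    simp only [Set.mem_ofPred_eq, Set.Finite.coe_toFinset]
    exact_mod_cast Iff.rfl
  have h : ∑' x : {x : GaussianInt // Zsqrtd.norm x < (N : ℤ)}, f x =
      ∑ x ∈ (finite_norm_lt N).toFinset, f x := by
    rw [← Finset.tsum_subtype', ← hset]
    rfl
  rw [h, normBall, Finset.add_sum_erase]
  simpa using hN

lemma eventually_log_rpow_le (a : ℝ) : ∃ N₀ : ℕ, ∀ N : ℕ, N > N₀ → Real.log N ^ a ≤ N := by
  have h := (isLittleO_log_rpow_rpow_atTop a one_pos).bound one_pos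
  obtain ⟨N₀, hN₀⟩ := Filter.eventually_atTop.1 (tendsto_natCast_atTop_atTop.eventually h)
  refine ⟨N₀, fun N hN => ?_⟩
  have := hN₀ N hN.le
  rw [Real.rpow_one, one_mul, Real.norm_natCast] at this
  exact (le_abs_self _).trans this

lemma sum_divCount_moment_le {k ε : ℝ} (hε : 0 < ε) :
    ∃ A : ℝ, 0 ≤ A ∧ ∀ Q M : ℝ, 1 < Q → 0 ≤ M →
      ∑ x ∈ normBall M, (divCount Q x : ℝ) ^ k ≤ A * Q ^ ε * M := by
  obtain ⟨Z, hZ, hbound⟩ := divMoment_zero_le (δ := ε / 2 ^ ⌈k⌉₊) (by positivity)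
  refine ⟨9 * Z ^ 2 ^ ⌈k⌉₊, by positivity, fun Q M hQ hM => ?_⟩
  have hQ0 : 0 ≤ Q := by linarith
  calc ∑ x ∈ normBall M, (divCount Q x : ℝ) ^ k
      ≤ ∑ x ∈ normBall M, (divCount Q x : ℝ) ^ ⌈k⌉₊ := by
        refine Finset.sum_le_sum fun x _ => ?_
        rw [← Real.rpow_natCast]
        exact Real.rpow_le_rpow_of_exponent_le (by exact_mod_cast one_le_divCount hQ x)
          (Nat.le_ceil k)
    _ ≤ 9 * divMoment Q 0 ^ 2 ^ ⌈k⌉₊ * M := sum_divCount_pow_le hQ _ hM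
    _ ≤ 9 * (Z * Q ^ (ε / 2 ^ ⌈k⌉₊)) ^ 2 ^ ⌈k⌉₊ * M := by
        have h1 := hbound Q hQ0
        have h2 := divMoment_nonneg Q 0
        gcongr
    _ = 9 * Z ^ 2 ^ ⌈k⌉₊ * Q ^ ε * M := by
        have e : (Q ^ (ε / 2 ^ ⌈k⌉₊)) ^ 2 ^ ⌈k⌉₊ = Q ^ ε := by
          rw [← Real.rpow_natCast, ← Real.rpow_mul hQ0]
          congr 1
          push_cast
          field_simp
        rw [mul_pow, e]; ring

theorem ramanujan_moment_bound (B k ε : ℝ) (hB : 2 < B) (hk : 2 < k) (hε : 0 < ε) :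
    ∃ C : ℝ, ∃ N₀ : ℕ, ∀ N : ℕ, N > N₀ → ∀ Q : ℝ, 2 ≤ Q → Q ≤ (Real.log N) ^ B →
      (1 / N : ℝ) * ∑' x : {x : GaussianInt // Zsqrtd.norm x < (N : ℤ)},
          (∑' q : {q : GaussianInt // IsCanon q ∧ (Zsqrtd.norm q : ℝ) < Q},
              ‖gtau (q : GaussianInt) (x : GaussianInt)‖) ^ k
        ≤ C * Q ^ (k + ε) := by
  obtain ⟨A, hA, hmoment⟩ := sum_divCount_moment_le (k := k) hε
  obtain ⟨N₀, hN₀⟩ := eventually_log_rpow_le (B * k)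
  refine ⟨162 ^ k * (9 ^ k + A), N₀, fun N hN Q hQ2 hQ => ?_⟩
  have hk0 : 0 ≤ k := by linarith
  have hQ0 : 0 ≤ Q := by linarith
  have hQ1 : 1 < Q := by linarith
  have hNpos : 0 < N := by omega
  have hNR : (0 : ℝ) < N := by exact_mod_cast hNpos
  have hlog : 0 ≤ Real.log N := Real.log_natCast_nonneg N
  have hQk : Q ^ k ≤ N := by
    refine le_trans ?_ (hN₀ N hN)
    rw [Real.rpow_mul hlog]
    exact Real.rpow_le_rpow hQ0 hQ hk0
  have hpoint : ∀ x : GaussianInt,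
      (∑' q : {q : GaussianInt // IsCanon q ∧ (Zsqrtd.norm q : ℝ) < Q},
        ‖gtau (q : GaussianInt) x‖) ^ k ≤ 162 ^ k * Q ^ k * (divCount Q x : ℝ) ^ k := by
    intro x
    rw [← Real.mul_rpow (by norm_num) hQ0, ← Real.mul_rpow (by positivity) (by positivity)]
    exact Real.rpow_le_rpow (tsum_nonneg fun _ => _root_.norm_nonneg _)
      (tsum_norm_gtau_le hQ0 x) hk0
  rw [tsum_norm_lt_eq N (fun x => (∑' q : {q : GaussianInt // IsCanon q ∧
    (Zsqrtd.norm q : ℝ) < Q}, ‖gtau (q : GaussianInt) x‖) ^ k) hNpos]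
  have hzero : (divCount Q 0 : ℝ) ^ k ≤ 9 ^ k * Q ^ ε * N := by
    calc (divCount Q 0 : ℝ) ^ k ≤ (9 * Q) ^ k :=
          Real.rpow_le_rpow (by positivity) (divCount_zero_le hQ0) hk0
      _ = 9 ^ k * 1 * Q ^ k := by rw [Real.mul_rpow (by norm_num) hQ0, mul_one]
      _ ≤ 9 ^ k * Q ^ ε * N := by
          have := Real.one_le_rpow hQ1.le hε.le
          gcongr
  have hsum := hmoment Q N hQ1 hNR.le
  rw [one_div, inv_mul_le_iff₀ hNR]
  calc _ ≤ 162 ^ k * Q ^ k * (divCount Q 0 : ℝ) ^ k +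
        ∑ x ∈ normBall N, 162 ^ k * Q ^ k * (divCount Q x : ℝ) ^ k :=
        add_le_add (hpoint 0) (Finset.sum_le_sum fun x _ => hpoint x)
    _ = 162 ^ k * Q ^ k *
        ((divCount Q 0 : ℝ) ^ k + ∑ x ∈ normBall N, (divCount Q x : ℝ) ^ k) := by
        rw [← Finset.mul_sum, mul_add]
    _ ≤ 162 ^ k * Q ^ k * (9 ^ k * Q ^ ε * N + A * Q ^ ε * N) := by gcongr
    _ = N * (162 ^ k * (9 ^ k + A) * Q ^ (k + ε)) := by
        rw [Real.rpow_add (by linarith)]; ring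

end
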